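/- arXiv:1712.04187 — 6 statements merged into one kernel-verified Lean document; each statement's English description precedes it below -/
import Mathlib

section
/- Let λ₁, λ₂, λ₃ be real numbers with λ₁ ≥ 0 > λ₃ ≥ λ₂ and λ₁ + λ₂ + λ₃ = 0. Set a₁ = √(|λ₁λ₂|/2) − |λ₃|/2, a₂ = |λ₃|/2, a₃ = |λ₃|/2. Then a₁, a₂, a₃ are positive real numbers and the 3×3 cell matrix D(a) constructed from the vector a = (a₁, a₂, a₃) has spectrum {λ₁, λ₂, λ₃}; equivalently, the characteristic polynomial of D(a) equals (x − λ₁)(x − λ₂)(x − λ₃). -/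
open Polynomial Matrix

/-- The cell matrix associated to a vector `x` of real numbers:
`(D(x))_{ij} = 0` if `i = j` and `x_i + x_j` otherwise. -/
def cellMatrix {n : Type*} [DecidableEq n] (x : n → ℝ) : Matrix n n ℝ :=
  fun i j => if i = j then 0 else x i + x j

theorem cell_IEP_3x3 (l1 l2 l3 : ℝ) (h1 : l1 ≥ 0) (h2 : 0 > l3) (h3 : l3 ≥ l2)
    (hsum : l1 + l2 + l3 = 0) (a : Fin 3 → ℝ)
    (ha : a = ![Real.sqrt (|l1 * l2| / 2) - |l3| / 2, |l3| / 2, |l3| / 2]) :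
    (∀ i, 0 < a i) ∧
      (cellMatrix a).charpoly = (X - C l1) * (X - C l2) * (X - C l3) := by
  have hprod : |l1 * l2| = -(l1 * l2) :=
    abs_of_nonpos (mul_nonpos_of_nonneg_of_nonpos h1 (by linarith))
  rw [hprod, abs_of_neg h2] at ha
  have hnonneg : 0 ≤ -(l1 * l2) / 2 := by nlinarith
  have hsq := Real.sq_sqrt hnonneg
  have hlt : -l3 / 2 < √(-(l1 * l2) / 2) := by
    apply Real.lt_sqrt_of_sq_lt
    nlinarith
  generalize √(-(l1 * l2) / 2) = s at *
  subst ha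
  refine ⟨fun i => ?_, ?_⟩
  · fin_cases i <;> simp <;> linarith
  · have hl1 : l1 = -l2 - l3 := by linarith
    have hD : cellMatrix ![s - -l3 / 2, -l3 / 2, -l3 / 2] = !![0, s, s; s, 0, -l3; s, -l3, 0] := by
      ext i j
      fin_cases i <;> fin_cases j <;> simp [cellMatrix]
    have hC : (C s : ℝ[X]) ^ 2 * 2 = -(C l1 * C l2) := by
      rw [← C_pow, ← C_mul, ← C_neg, hsq, ← C_ofNat, ← C_mul]
      congr 1
      ring
    have hCl1 : (C l1 : ℝ[X]) = -C l2 - C l3 := by rw [hl1, C_sub, C_neg]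
    rw [hD, Matrix.charpoly, Matrix.det_fin_three]
    simp
    rw [hCl1] at hC ⊢
    linear_combination (C l3 - X) * hC
end

section
/- Let a₁, a₂, a₃ be positive real numbers and let D(a) be the 3×3 cell matrix constructed from a = (a₁, a₂, a₃). Setting α = a₁ + a₂, β = a₁ + a₃ and γ = a₂ + a₃, the characteristic polynomial of D(a) equals x³ − (α² + β² + γ²)·x − 2αβγ. -/
open Polynomial Matrix

theorem cell_charpoly_3x3 (a : Fin 3 → ℝ) (ha : ∀ i, 0 < a i) :
    (cellMatrix a).charpoly =
      X ^ 3 - C ((a 0 + a 1) ^ 2 + (a 0 + a 2) ^ 2 + (a 1 + a 2) ^ 2) * X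
        - C (2 * (a 0 + a 1) * (a 0 + a 2) * (a 1 + a 2)) := by
  have map_two : (C 2 : ℝ[X]) = 2 := map_ofNat C 2
  simp only [Matrix.charpoly, Matrix.det_fin_three, charmatrix_apply, Matrix.diagonal_apply,
    cellMatrix, Fin.reduceEq, if_true, if_false, map_add, map_mul, map_pow, map_zero, map_two]
  ring
end

section
/- Let a₁, a₂, a₃ be positive real numbers, let D(a) be the 3×3 cell matrix constructed from a = (a₁, a₂, a₃), and suppose the spectrum of D(a) is {λ₁, λ₂, λ₃} where λ₁ ≥ 0 > λ₃ ≥ λ₂ and λ₁ + λ₂ + λ₃ = 0. If a₂ + a₃ = |λ₃|, then a₂ = a₃ = |λ₃|/2 and a₁ + a₂ = a₁ + a₃ = √(|λ₁λ₂|/2). -/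
open Polynomial Matrix

/-- The characteristic polynomial of a `3 × 3` cell matrix, evaluated at a point. -/
theorem eval_charpoly_cellMatrix_fin_three (a : Fin 3 → ℝ) (t : ℝ) :
    (cellMatrix a).charpoly.eval t =
      t ^ 3 - ((a 0 + a 1) ^ 2 + (a 0 + a 2) ^ 2 + (a 1 + a 2) ^ 2) * t
        - 2 * (a 0 + a 1) * (a 0 + a 2) * (a 1 + a 2) := by
  rw [Matrix.eval_charpoly, Matrix.det_fin_three]
  simp [cellMatrix]
  ring

theorem cell_3x3_entries_determined (a : Fin 3 → ℝ) (ha : ∀ i, 0 < a i)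
    (l1 l2 l3 : ℝ) (h1 : l1 ≥ 0) (h2 : 0 > l3) (h3 : l3 ≥ l2)
    (hsum : l1 + l2 + l3 = 0)
    (hspec : (cellMatrix a).charpoly = (X - C l1) * (X - C l2) * (X - C l3))
    (h23 : a 1 + a 2 = |l3|) :
    a 1 = |l3| / 2 ∧ a 2 = |l3| / 2 ∧
      a 0 + a 1 = Real.sqrt (|l1 * l2| / 2) ∧
      a 0 + a 2 = Real.sqrt (|l1 * l2| / 2) := by
  have eval_eq (t : ℝ) := (eval_charpoly_cellMatrix_fin_three a t).symm.trans
    (congrArg (eval t) hspec)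
  simp only [eval_mul, eval_sub, eval_X, eval_C] at eval_eq
  have habs : |l3| = -l3 := abs_of_neg h2
  have hprod : |l1 * l2| = -(l1 * l2) :=
    abs_of_nonpos (mul_nonpos_of_nonneg_of_nonpos h1 (h3.trans h2.le))
  rw [habs] at h23 ⊢
  rw [hprod]
  have hl3 := eval_eq l3
  have hdet := eval_eq 0
  rw [h23] at hl3 hdet
  have hsq : l3 * (a 1 - a 2) ^ 2 = 0 := by linear_combination -hl3
  have h12 : a 1 = a 2 :=
    sub_eq_zero.mp (pow_eq_zero_iff two_ne_zero |>.mp ((mul_eq_zero.mp hsq).resolve_left h2.ne))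
  have hsqrt : a 0 + a 2 = Real.sqrt (-(l1 * l2) / 2) := by
    rw [h12] at hdet
    have hmul : (a 0 + a 2) ^ 2 = -(l1 * l2) / 2 :=
      mul_left_cancel₀ h2.ne (by linear_combination hdet / 2)
    rw [← hmul, Real.sqrt_sq (add_pos (ha 0) (ha 2)).le]
  exact ⟨by linarith, by linarith, h12 ▸ hsqrt, hsqrt⟩
end

section
/- Let k ≥ 1 and let l₁, …, l_k be integers with l_i > 1 for all i and l₁ + ⋯ + l_k = n. Let λ_{k+1}, …, λ_{2k} be negative real numbers and set x_i = −λ_{k+i}/2 > 0 for i = 1, …, k. Let x ∈ ℝⁿ be the vector whose first l₁ coordinates equal x₁, next l₂ coordinates equal x₂, …, and last l_k coordinates equal x_k, and let D(x) be the n×n cell matrix constructed from x. Let D^{(k)} be the k×k real matrix with entries D^{(k)}_{ij} = (l_{k−j+1} − 1)·(2 x_{k−j+1}) if i = j and D^{(k)}_{ij} = l_{k−j+1}·(x_{k−j+1} + x_{k−i+1}) if i ≠ j. Then the characteristic polynomial of D(x) equals the characteristic polynomial of D^{(k)} multiplied by ∏_{i=1}^{k} (X − λ_{k+i})^{l_i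 − 1}. In particular, if λ₁, …, λ_k are the roots of the characteristic polynomial of D^{(k)}, then the spectrum of D(x) is the multiset consisting of λ₁, …, λ_k together with each λ_{k+i} repeated l_i − 1 times. -/
open Polynomial Matrix

/-- The determinants of two square matrices intertwined by `P` change by the same factor when
`P * Q` is subtracted from the first and `Q * P` from the second. -/
theorem det_sub_mul_mul_det_of_intertwine {R m n : Type*} [CommRing R]
    [Fintype m] [DecidableEq m] [Fintype n] [DecidableEq n]
    {A : Matrix m m R} {A' : Matrix n n R} {P : Matrix m n R} (h : A * P = P * A')
    (Q : Matrix n m R) :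
    (A - P * Q).det * A'.det = A.det * (A' - Q * P).det := by
  have hfactor : fromBlocks 1 P 0 1 * fromBlocks (A - P * Q) 0 Q A' =
      fromBlocks A 0 Q (A' - Q * P) * fromBlocks 1 P 0 1 := by
    simp [fromBlocks_multiply, h]
  simpa [det_mul] using congrArg det hfactor

/-- Theorem 3.2 (main theorem): the charpoly of the block cell matrix built from
the vector with `lᵢ` copies of `xᵢ = -λ_{k+i}/2` factors as the charpoly of the
`k × k` matrix `D^{(k)}` times `∏ᵢ (X - λ_{k+i})^{lᵢ - 1}`.  The index set of the
cell matrix is `Σ i : Fin k, Fin (l i)`, whose first block has `l₁` elements, etc. -/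
theorem cell_charpoly_block (k : ℕ) (hk : 1 ≤ k) (l : Fin k → ℕ) (hl : ∀ i, 1 < l i)
    (lam : Fin k → ℝ) (hlam : ∀ i, lam i < 0)
    (x : Fin k → ℝ) (hx : ∀ i, x i = -lam i / 2)
    (v : (Σ i : Fin k, Fin (l i)) → ℝ) (hv : ∀ p, v p = x p.1)
    (M : Matrix (Fin k) (Fin k) ℝ)
    (hM : ∀ i j, M i j =
      if i = j then ((l j.rev : ℝ) - 1) * (2 * x j.rev)
      else (l j.rev : ℝ) * (x j.rev + x i.rev)) :
    (cellMatrix v).charpoly = M.charpoly * ∏ i, (X - C (lam i)) ^ (l i - 1) := by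
  let A : Matrix (Σ i : Fin k, Fin (l i)) (Σ i : Fin k, Fin (l i)) ℝ[X] :=
    diagonal fun p => X - C (lam p.1)
  let A' : Matrix (Fin k) (Fin k) ℝ[X] := diagonal fun i => X - C (lam i)
  let P : Matrix (Σ i : Fin k, Fin (l i)) (Fin k) ℝ[X] := of fun p j => if p.1 = j then 1 else 0
  let Q : Matrix (Fin k) (Σ i : Fin k, Fin (l i)) ℝ[X] := of fun j p => C (x j + x p.1)
  have hAP : A * P = P * A' := by
    ext1 p j
    by_cases h : p.1 = j <;> simp [A, A', P, diagonal_mul, mul_diagonal, h]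
  have hlam_eq : ∀ i, lam i = -(x i + x i) := fun i => by rw [hx]; ring
  have hD : (cellMatrix v).charpoly = (A - P * Q).det := by
    rw [Matrix.charpoly]
    congr 1
    ext1 p q
    by_cases h : p = q
    · subst h
      simp [A, P, Q, mul_apply, cellMatrix, hlam_eq]
      ring
    · simp [A, P, Q, mul_apply, cellMatrix, hv, h]
  have hQP : ∀ i j, (Q * P) i j = C ((l j : ℝ) * (x i + x j)) := by
    intro i j
    simp [P, Q, mul_apply, Fintype.sum_sigma]
    ring
  have hM' : M.charpoly = (A' - Q * P).det := by
    rw [← charpoly_reindex Fin.revPerm M, Matrix.charpoly]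
    congr 1
    ext1 i j
    rw [Matrix.sub_apply, hQP]
    by_cases h : i = j
    · subst h
      simp [A', hM, hlam_eq, two_mul]
      ring
    · simp [A', hM, h, add_comm]
  have hA : A.det = A'.det * ∏ i, (X - C (lam i)) ^ (l i - 1) := by
    simp only [A, A', det_diagonal, Fintype.prod_sigma, Finset.prod_const, Finset.card_univ,
      Fintype.card_fin, ← Finset.prod_mul_distrib]
    exact Finset.prod_congr rfl fun i _ => (mul_pow_sub_one (by have := hl i; omega) _).symm
  have hA' : A'.det ≠ 0 := by
    rw [det_diagonal]
    exact Finset.prod_ne_zero_iff.mpr fun i _ => X_sub_C_ne_zero _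
  apply mul_right_cancel₀ hA'
  rw [hD, det_sub_mul_mul_det_of_intertwine hAP, hA, hM']
  ring
end

section
/- Let l₁, l₂ be integers with l₁, l₂ > 1 and n = l₁ + l₂. Let λ₃, λ₄ be negative real numbers, and define λ₁ = [(l₁−1)(−λ₃/2) + (l₂−1)(−λ₄/2)] + √((l₁(n−2)+1)(−λ₃/2)² + (1/2)(n−1)λ₃λ₄ + (n² − n(l₁+2) + 2l₁ + 1)(−λ₄/2)²) and λ₂ = [(l₁−1)(−λ₃/2) + (l₂−1)(−λ₄/2)] − √((l₁(n−2)+1)(−λ₃/2)² + (1/2)(n−1)λ₃λ₄ + (n² − n(l₁+2) + 2l₁ + 1)(−λ₄/2)²). Then the n×n cell matrix D(x) constructed from the vector x whose first l₁ coordinates equal −λ₃/2 and whose last l₂ coordinates equal −λ₄/2 has spectrum the multiset consisting of λ₁, λ₂, the value λ₃ repeated l₁ − 1 times, and the value λ₄ repeated l₂ − 1 times; equivalently, its characteristic polynomial equals (X − λ₁)(X − λ₂)(X − λ₃)^{l₁−1}(X − λ₄)^{l₂−1}. -/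
open Polynomial Matrix

/-- The cell matrix is a rank-two perturbation of a diagonal matrix, so its characteristic
polynomial can be evaluated by the matrix determinant lemma wherever the diagonal part of
`t • 1 - D(x)` is invertible. -/
theorem eval_charpoly_cellMatrix {n : Type*} [Fintype n] [DecidableEq n] (x : n → ℝ) (t : ℝ)
    (ht : ∀ i, t + 2 * x i ≠ 0) :
    (cellMatrix x).charpoly.eval t =
      (∏ i, (t + 2 * x i)) * ((1 - ∑ i, x i / (t + 2 * x i)) ^ 2 -
        (∑ i, 1 / (t + 2 * x i)) * ∑ i, x i ^ 2 / (t + 2 * x i)) := by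
  set U : Matrix n (Fin 2) ℝ := Matrix.of fun i => ![-x i, -1] with hU
  set V : Matrix (Fin 2) n ℝ := Matrix.of ![fun _ => 1, x] with hV
  have hsub : Matrix.scalar n t - cellMatrix x = diagonal (fun i => t + 2 * x i) + U * V := by
    ext i j
    by_cases hij : i = j
    · subst hij
      simp [cellMatrix, hU, hV, Matrix.mul_apply, Fin.sum_univ_two]
      ring
    · simp [cellMatrix, hU, hV, Matrix.mul_apply, Fin.sum_univ_two, hij]
      ring
  have hdet : IsUnit (diagonal (fun i => t + 2 * x i)).det := by
    rw [det_diagonal, isUnit_iff_ne_zero]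
    exact Finset.prod_ne_zero_iff.mpr fun i _ => ht i
  have hinv : (diagonal (fun i => t + 2 * x i))⁻¹ = diagonal (fun i => (t + 2 * x i)⁻¹) := by
    refine Matrix.inv_eq_right_inv ?_
    rw [diagonal_mul_diagonal, ← diagonal_one]
    congr 1
    ext i
    exact mul_inv_cancel₀ (ht i)
  have entry : ∀ k l, (V * diagonal (fun i => (t + 2 * x i)⁻¹) * U) k l =
      ∑ i, V k i * (t + 2 * x i)⁻¹ * U i l := by
    intro k l
    simp only [Matrix.mul_apply (N := U), mul_diagonal]
  rw [eval_charpoly, hsub, det_add_mul U V hdet, hinv, det_diagonal]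
  congr 1
  rw [det_fin_two]
  simp only [Matrix.add_apply, entry]
  have h₁ : ∑ i, x i / (t + 2 * x i) = ∑ i, (t + 2 * x i)⁻¹ * x i :=
    Finset.sum_congr rfl fun i _ => by ring
  have h₂ : ∑ i, x i ^ 2 / (t + 2 * x i) = ∑ i, x i * (t + 2 * x i)⁻¹ * x i :=
    Finset.sum_congr rfl fun i _ => by ring
  have h₃ : ∑ i, x i * (t + 2 * x i)⁻¹ = ∑ i, (t + 2 * x i)⁻¹ * x i :=
    Finset.sum_congr rfl fun i _ => by ring
  simp [hU, hV, h₁, h₂, h₃]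
  ring

theorem cell_charpoly_two_blocks (l1 l2 : ℕ) (hl1 : 1 < l1) (hl2 : 1 < l2)
    (n : ℕ) (hn : n = l1 + l2)
    (l3 l4 : ℝ) (h3 : l3 < 0) (h4 : l4 < 0) (lam1 lam2 : ℝ)
    (hlam1 : lam1 = (((l1 : ℝ) - 1) * (-l3 / 2) + ((l2 : ℝ) - 1) * (-l4 / 2)) +
      Real.sqrt (((l1 : ℝ) * ((n : ℝ) - 2) + 1) * (-l3 / 2) ^ 2 +
        (1 / 2) * ((n : ℝ) - 1) * l3 * l4 +
        ((n : ℝ) ^ 2 - (n : ℝ) * ((l1 : ℝ) + 2) + 2 * (l1 : ℝ) + 1) * (-l4 / 2) ^ 2))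
    (hlam2 : lam2 = (((l1 : ℝ) - 1) * (-l3 / 2) + ((l2 : ℝ) - 1) * (-l4 / 2)) -
      Real.sqrt (((l1 : ℝ) * ((n : ℝ) - 2) + 1) * (-l3 / 2) ^ 2 +
        (1 / 2) * ((n : ℝ) - 1) * l3 * l4 +
        ((n : ℝ) ^ 2 - (n : ℝ) * ((l1 : ℝ) + 2) + 2 * (l1 : ℝ) + 1) * (-l4 / 2) ^ 2))
    (x : Fin n → ℝ) (hx : ∀ j : Fin n, x j = if (j : ℕ) < l1 then -l3 / 2 else -l4 / 2) :
    (cellMatrix x).charpoly =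
      (X - C lam1) * (X - C lam2) * (X - C l3) ^ (l1 - 1) * (X - C l4) ^ (l2 - 1) := by
  subst hn
  have hdisc : 0 ≤ ((l1 : ℝ) * (((l1 + l2 : ℕ) : ℝ) - 2) + 1) * (-l3 / 2) ^ 2 +
      (1 / 2) * (((l1 + l2 : ℕ) : ℝ) - 1) * l3 * l4 +
      (((l1 + l2 : ℕ) : ℝ) ^ 2 - ((l1 + l2 : ℕ) : ℝ) * ((l1 : ℝ) + 2) + 2 * (l1 : ℝ) + 1) *
        (-l4 / 2) ^ 2 := by
    have : 0 ≤ (((l1 : ℝ) - 1) * (-l3 / 2) - ((l2 : ℝ) - 1) * (-l4 / 2)) ^ 2 +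
        (-l3 / 2 + -l4 / 2) ^ 2 * (l1 * l2) := by positivity
    refine this.trans_eq ?_
    push_cast
    ring
  have hsq := Real.sq_sqrt hdisc
  set s := Real.sqrt (((l1 : ℝ) * (((l1 + l2 : ℕ) : ℝ) - 2) + 1) * (-l3 / 2) ^ 2 +
      (1 / 2) * (((l1 + l2 : ℕ) : ℝ) - 1) * l3 * l4 +
      (((l1 + l2 : ℕ) : ℝ) ^ 2 - ((l1 + l2 : ℕ) : ℝ) * ((l1 : ℝ) + 2) + 2 * (l1 : ℝ) + 1) *
        (-l4 / 2) ^ 2)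
  push_cast at hsq
  refine Polynomial.eq_of_infinite_eval_eq _ _ ?_
  refine (Set.Finite.infinite_compl (Set.toFinite {l3, l4})).mono fun t ht => ?_
  obtain ⟨ht3, ht4⟩ : t ≠ l3 ∧ t ≠ l4 := by simpa using ht
  have h3' := sub_ne_zero.mpr ht3
  have h4' := sub_ne_zero.mpr ht4
  have hx1 : ∀ i : Fin l1, x (Fin.castAdd l2 i) = -l3 / 2 := fun i => by simp [hx]
  have hx2 : ∀ i : Fin l2, x (Fin.natAdd l1 i) = -l4 / 2 := fun i => by simp [hx]
  have e3 : t + 2 * (-l3 / 2) = t - l3 := by ring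
  have e4 : t + 2 * (-l4 / 2) = t - l4 := by ring
  have hne : ∀ i, t + 2 * x i ≠ 0 := fun i => by
    rw [hx]
    split_ifs
    · rwa [e3]
    · rwa [e4]
  rw [Set.mem_ofPred_eq, eval_charpoly_cellMatrix x t hne]
  obtain ⟨p, rfl⟩ : ∃ p, l1 = p + 1 := ⟨l1 - 1, by omega⟩
  obtain ⟨q, rfl⟩ : ∃ q, l2 = q + 1 := ⟨l2 - 1, by omega⟩
  simp only [Fin.prod_univ_add (a := p + 1) (b := q + 1),
    Fin.sum_univ_add (a := p + 1) (b := q + 1), hx1, hx2, e3, e4, Finset.sum_const,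
    Finset.prod_const, Finset.card_univ, Fintype.card_fin, nsmul_eq_mul, eval_mul, eval_sub,
    eval_pow, eval_X, eval_C, hlam1, hlam2, Nat.add_sub_cancel]
  push_cast at hsq ⊢
  have key : (t - l3) * (t - l4) *
      ((1 - ((p + 1) * (-l3 / 2 / (t - l3)) + (q + 1) * (-l4 / 2 / (t - l4)))) ^ 2 -
        ((p + 1) * (1 / (t - l3)) + (q + 1) * (1 / (t - l4))) *
          ((p + 1) * ((-l3 / 2) ^ 2 / (t - l3)) + (q + 1) * ((-l4 / 2) ^ 2 / (t - l4)))) =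
      (t - ((p + 1 - 1) * (-l3 / 2) + (q + 1 - 1) * (-l4 / 2))) ^ 2 - s ^ 2 := by
    rw [hsq]
    field_simp
    ring
  linear_combination (t - l3) ^ p * (t - l4) ^ q * key
end

section
/- Let l₁, l₂ be positive integers with n = l₁ + l₂, and let λ₃, λ₄ be negative real numbers. Consider the 2×2 real matrix M with entries M₁₁ = −(l₂−1)λ₄, M₁₂ = −(l₁/2)(λ₃+λ₄), M₂₁ = −(l₂/2)(λ₃+λ₄), M₂₂ = −(l₁−1)λ₃. Then the eigenvalues of M are [(l₁−1)(−λ₃/2) + (l₂−1)(−λ₄/2)] ± √((l₁(n−2)+1)(−λ₃/2)² + (1/2)(n−1)λ₃λ₄ + (n² − n(l₁+2) + 2l₁ + 1)(−λ₄/2)²). -/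
open Polynomial Matrix

/-- The characteristic polynomial of a real `2 × 2` matrix with half-trace `t` and nonnegative
reduced discriminant `D` splits with roots `t ± √D`. -/
theorem charpoly_fin_two_eq_mul_of_discrim_nonneg {a b c d t D : ℝ} (ht : a + d = 2 * t)
    (hD : ((a - d) / 2) ^ 2 + b * c = D) (hD_nonneg : 0 ≤ D) :
    (!![a, b; c, d]).charpoly = (X - C (t + √D)) * (X - C (t - √D)) := by
  have hdet : a * d - b * c = (t + √D) * (t - √D) := by
    have hsq := Real.sq_sqrt hD_nonneg
    have ht' : t = (a + d) / 2 := by linarith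
    subst ht'
    linear_combination hsq - hD
  have htrace : a + d = (t + √D) + (t - √D) := by linarith
  rw [Matrix.charpoly_fin_two, Matrix.trace_fin_two_of, Matrix.det_fin_two_of, hdet, htrace,
    C_add, C_mul]
  ring

theorem two_by_two_eigenvalues (l1 l2 : ℕ) (h1 : 0 < l1) (h2 : 0 < l2)
    (n : ℕ) (hn : n = l1 + l2) (l3 l4 : ℝ) (h3 : l3 < 0) (h4 : l4 < 0) :
    (!![-(((l2 : ℝ) - 1)) * l4, -((l1 : ℝ) / 2) * (l3 + l4);
        -((l2 : ℝ) / 2) * (l3 + l4), -(((l1 : ℝ) - 1)) * l3]).charpoly =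
      (X - C ((((l1 : ℝ) - 1) * (-l3 / 2) + ((l2 : ℝ) - 1) * (-l4 / 2)) +
        Real.sqrt (((l1 : ℝ) * ((n : ℝ) - 2) + 1) * (-l3 / 2) ^ 2 +
          (1 / 2) * ((n : ℝ) - 1) * l3 * l4 +
          ((n : ℝ) ^ 2 - (n : ℝ) * ((l1 : ℝ) + 2) + 2 * (l1 : ℝ) + 1) * (-l4 / 2) ^ 2))) *
      (X - C ((((l1 : ℝ) - 1) * (-l3 / 2) + ((l2 : ℝ) - 1) * (-l4 / 2)) -
        Real.sqrt (((l1 : ℝ) * ((n : ℝ) - 2) + 1) * (-l3 / 2) ^ 2 +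
          (1 / 2) * ((n : ℝ) - 1) * l3 * l4 +
          ((n : ℝ) ^ 2 - (n : ℝ) * ((l1 : ℝ) + 2) + 2 * (l1 : ℝ) + 1) * (-l4 / 2) ^ 2))) := by
  subst hn
  push_cast
  refine charpoly_fin_two_eq_mul_of_discrim_nonneg (by ring) (by ring) ?_
  calc (0 : ℝ)
      ≤ ((((l1 : ℝ) - 1) * l3 - ((l2 : ℝ) - 1) * l4) / 2) ^ 2 +
          (l1 : ℝ) * (l2 : ℝ) * ((l3 + l4) / 2) ^ 2 := by positivity
    _ = _ := by ring
end
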